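/- There is a constant c_1 = c_1(d,c) > 0 such that for every finite set A of points in ℍ^d with the property that the distance between any two of its points is at least c, at least c_1·|A| points of A are at distance at most (1−c)/2 from the boundary of the convex hull of A. -/

import Mathlib

open Metric Set MeasureTheory ENNReal

noncomputable section

/-- Inverse hyperbolic cosine. -/
def arcosh (t : ℝ) : ℝ := Real.log (t + Real.sqrt (t ^ 2 - 1))

/-- The Poincaré ball model of `d`-dimensional hyperbolic space `ℍ^d`:
the open unit ball of `ℝ^d`. -/
def hSpace (d : ℕ) : Set (EuclideanSpace ℝ (Fin d)) := Metric.ball 0 1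

/-- The hyperbolic distance between two points of the Poincaré ball. -/
def hDist {d : ℕ} (x y : EuclideanSpace ℝ (Fin d)) : ℝ :=
  arcosh (1 + 2 * ‖x - y‖ ^ 2 / ((1 - ‖x‖ ^ 2) * (1 - ‖y‖ ^ 2)))

/-- The hyperbolic distance from a point to a set of points. -/
def hDistSet {d : ℕ} (x : EuclideanSpace ℝ (Fin d)) (S : Set (EuclideanSpace ℝ (Fin d))) : ℝ :=
  sInf (hDist x '' S)

/-- The geodesic segment between two points of hyperbolic space, described metrically as the
set of points lying between its two endpoints (hyperbolic space is uniquely geodesic). -/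
def hSeg {d : ℕ} (x y : EuclideanSpace ℝ (Fin d)) : Set (EuclideanSpace ℝ (Fin d)) :=
  {z ∈ hSpace d | hDist x z + hDist z y = hDist x y}

/-- A subset of hyperbolic space is (geodesically) convex if it contains the geodesic segment
between any two of its points. -/
def HConvex {d : ℕ} (K : Set (EuclideanSpace ℝ (Fin d))) : Prop :=
  K ⊆ hSpace d ∧ ∀ x ∈ K, ∀ y ∈ K, hSeg x y ⊆ K

/-- The (hyperbolic) convex hull of a set: the smallest geodesically convex subset of `ℍ^d`
containing it. -/
def hHull {d : ℕ} (A : Set (EuclideanSpace ℝ (Fin d))) : Set (EuclideanSpace ℝ (Fin d)) :=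
  ⋂₀ {K | HConvex K ∧ A ⊆ K}

/-- The boundary of a subset of hyperbolic space. -/
def hFrontier {d : ℕ} (K : Set (EuclideanSpace ℝ (Fin d))) : Set (EuclideanSpace ℝ (Fin d)) :=
  hSpace d ∩ frontier K

/-- The open hyperbolic ball of radius `r` around `x`. -/
def hBall {d : ℕ} (x : EuclideanSpace ℝ (Fin d)) (r : ℝ) : Set (EuclideanSpace ℝ (Fin d)) :=
  {y ∈ hSpace d | hDist x y < r}

/-- The hyperbolic volume of a subset of the Poincaré ball. -/
def hVol (d : ℕ) (S : Set (EuclideanSpace ℝ (Fin d))) : ℝ≥0∞ :=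
  ∫⁻ y in S, ENNReal.ofReal ((2 / (1 - ‖y‖ ^ 2)) ^ d)

/-- A set is `c`-separated if any two distinct points of it are at hyperbolic
distance at least `c`. -/
def hSep {d : ℕ} (c : ℝ) (A : Set (EuclideanSpace ℝ (Fin d))) : Prop :=
  ∀ x ∈ A, ∀ y ∈ A, x ≠ y → c ≤ hDist x y


/-- coordinates -/
lemma mph_arcosh_eq (t : ℝ) : arcosh t = Real.arcosh t := by
  simp [arcosh, Real.arcosh]

lemma mph_small (ε : ℝ) (hε : 0 < ε) : ∃ δ : ℝ, 0 < δ ∧ ∀ s, 0 ≤ s → s ≤ δ → arcosh (1 + s) < ε := by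
  refine ⟨(Real.cosh ε - 1) / 2, by have := Real.one_lt_cosh.2 hε.ne'; linarith, fun s h0 hs => ?_⟩
  have h1 := Real.one_lt_cosh.2 hε.ne'
  rw [mph_arcosh_eq, ← Real.arcosh_cosh hε.le]
  apply (Real.arcosh_lt_arcosh (by linarith) (by linarith)).2
  linarith

lemma mph_k {d : ℕ} {x : EuclideanSpace ℝ (Fin d)} (hx : x ∈ hSpace d) : 0 < 1 - ‖x‖ ^ 2 := by
  have : ‖x‖ < 1 := by simpa [hSpace] using hx
  nlinarith [norm_nonneg x]

lemma mph_arg {d : ℕ} {x y : EuclideanSpace ℝ (Fin d)} (hx : x ∈ hSpace d) (hy : y ∈ hSpace d) :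
    0 ≤ 2 * ‖x - y‖ ^ 2 / ((1 - ‖x‖ ^ 2) * (1 - ‖y‖ ^ 2)) := by
  have := mph_k hx
  have := mph_k hy
  positivity

lemma mph_nonneg {d : ℕ} {x y : EuclideanSpace ℝ (Fin d)} (hx : x ∈ hSpace d) (hy : y ∈ hSpace d) :
    0 ≤ hDist x y := by
  rw [hDist, mph_arcosh_eq]
  exact Real.arcosh_nonneg (by linarith [mph_arg hx hy])

lemma mph_cosh {d : ℕ} {x y : EuclideanSpace ℝ (Fin d)} (hx : x ∈ hSpace d) (hy : y ∈ hSpace d) :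
    Real.cosh (hDist x y) = 1 + 2 * ‖x - y‖ ^ 2 / ((1 - ‖x‖ ^ 2) * (1 - ‖y‖ ^ 2)) := by
  rw [hDist, mph_arcosh_eq]
  exact Real.cosh_arcosh (by linarith [mph_arg hx hy])

/-- time coordinate in the hyperboloid model -/
def mphT {d : ℕ} (x : EuclideanSpace ℝ (Fin d)) : ℝ := (1 + ‖x‖ ^ 2) / (1 - ‖x‖ ^ 2)

/-- space coordinate in the hyperboloid model -/
def mphS {d : ℕ} (x : EuclideanSpace ℝ (Fin d)) : EuclideanSpace ℝ (Fin d) :=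
  (2 / (1 - ‖x‖ ^ 2)) • x

lemma mph_form {d : ℕ} {x y : EuclideanSpace ℝ (Fin d)} (hx : x ∈ hSpace d) (hy : y ∈ hSpace d) :
    Real.cosh (hDist x y) = mphT x * mphT y - inner ℝ (mphS x) (mphS y) := by
  have h1 := mph_k hx
  have h2 := mph_k hy
  rw [mph_cosh hx hy, mphT, mphT, mphS, mphS, real_inner_smul_left, real_inner_smul_right,
    norm_sub_sq_real]
  field_simp
  ring

lemma mph_unit {d : ℕ} {x : EuclideanSpace ℝ (Fin d)} (hx : x ∈ hSpace d) :
    mphT x ^ 2 = 1 + inner ℝ (mphS x) (mphS x) := by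
  have h1 := mph_k hx
  rw [mphT, mphS, real_inner_smul_left, real_inner_smul_right, real_inner_self_eq_norm_sq]
  field_simp
  ring

lemma mph_zero {d : ℕ} (w z : EuclideanSpace ℝ (Fin d)) (a b : ℝ)
    (hz : b ^ 2 = 1 + inner ℝ z z) (hw : a ^ 2 = inner ℝ w w) (hwz : a * b = inner ℝ w z) :
    a = 0 ∧ w = 0 := by
  have h1 := real_inner_mul_inner_self_le w z
  have h2 : a ^ 2 * b ^ 2 ≤ a ^ 2 * (inner ℝ z z) := by
    calc a ^ 2 * b ^ 2 = (a * b) * (a * b) := by ring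
      _ ≤ _ := by rw [hwz, hw]; exact h1
  have h3 : a = 0 := by
    have : a ^ 2 ≤ 0 := by rw [hz] at h2; linarith
    nlinarith
  refine ⟨h3, ?_⟩
  rw [h3] at hw
  apply inner_self_eq_zero (𝕜 := ℝ).1
  rw [← hw]; ring

lemma mph_hconvex {d : ℕ} (n : EuclideanSpace ℝ (Fin d)) (m : ℝ) :
    HConvex {x ∈ hSpace d | 2 * inner ℝ n x ≤ m * (1 + ‖x‖ ^ 2)} := by
  have key : ∀ x ∈ hSpace d, (2 * inner ℝ n x ≤ m * (1 + ‖x‖ ^ 2) ↔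
      inner ℝ n (mphS x) - m * mphT x ≤ 0) := by
    intro x hx
    have h1 := mph_k hx
    have : inner ℝ n (mphS x) - m * mphT x =
        (2 * inner ℝ n x - m * (1 + ‖x‖ ^ 2)) / (1 - ‖x‖ ^ 2) := by
      rw [mphS, mphT, real_inner_smul_right]; field_simp
    rw [this, div_le_iff₀ h1]
    constructor <;> intro h <;> linarith
  refine ⟨fun x hx => hx.1, ?_⟩
  rintro x ⟨hx, hxn⟩ y ⟨hy, hyn⟩ z ⟨hz, hzd⟩
  refine ⟨hz, ?_⟩
  rw [key x hx] at hxn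
  rw [key y hy] at hyn
  rw [key z hz]
  have ha := mph_nonneg hx hz
  have hb := mph_nonneg hz hy
  have f1 := mph_form hx hz
  have f2 := mph_form hz hy
  have f3 := mph_form hx hy
  rw [← hzd] at f3
  have ux := mph_unit hx
  have uy := mph_unit hy
  have uz := mph_unit hz
  have cxz := mph_cosh hx hz
  set a := hDist x z
  set b := hDist z y
  have sa := Real.sinh_nonneg_iff.2 ha
  have sb := Real.sinh_nonneg_iff.2 hb
  rcases eq_or_lt_of_le (add_nonneg ha hb) with h0 | h0
  · have : a = 0 := by linarith
    rw [this, Real.cosh_zero] at cxz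
    have k1 := mph_k hx
    have k2 := mph_k hz
    have : ‖x - z‖ ^ 2 = 0 := by
      have : 2 * ‖x - z‖ ^ 2 / ((1 - ‖x‖ ^ 2) * (1 - ‖z‖ ^ 2)) = 0 := by linarith
      rw [_root_.div_eq_zero_iff] at this
      rcases this with h | h
      · linarith
      · exact absurd h (by positivity)
    have : x = z := by
      rw [← sub_eq_zero, ← norm_eq_zero]
      exact pow_eq_zero_iff (two_ne_zero) |>.1 this
    rw [← this]; exact hxn
  · have s0 := Real.sinh_pos_iff.2 h0
    rw [Real.cosh_add] at f3
    have ca := Real.cosh_sq a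
    have cb := Real.cosh_sq b
    have sadd := Real.sinh_add a b
    set A := Real.sinh a
    set B := Real.sinh b
    set A' := Real.cosh a
    set B' := Real.cosh b
    set S := Real.sinh (a + b)
    have e1 : inner ℝ (mphS x) (mphS x) = mphT x ^ 2 - 1 := by linarith
    have e2 : inner ℝ (mphS y) (mphS y) = mphT y ^ 2 - 1 := by linarith
    have e3 : inner ℝ (mphS z) (mphS z) = mphT z ^ 2 - 1 := by linarith
    have e4 : inner ℝ (mphS x) (mphS z) = mphT x * mphT z - A' := by linarith
    have e5 : inner ℝ (mphS z) (mphS y) = mphT z * mphT y - B' := by linarith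
    have e6 : inner ℝ (mphS x) (mphS y) = mphT x * mphT y - (A' * B' + A * B) := by linarith
    have e4' : inner ℝ (mphS z) (mphS x) = mphT x * mphT z - A' := by rw [real_inner_comm, e4]
    have e5' : inner ℝ (mphS y) (mphS z) = mphT z * mphT y - B' := by rw [real_inner_comm, e5]
    have e6' : inner ℝ (mphS y) (mphS x) = mphT x * mphT y - (A' * B' + A * B) := by
      rw [real_inner_comm, e6]
    obtain ⟨w0, w1⟩ := mph_zero (B • mphS x + A • mphS y - S • mphS z) (mphS z)
      (B * mphT x + A * mphT y - S * mphT z) (mphT z) uz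
      (by
        simp only [inner_sub_left, inner_sub_right, inner_add_left, inner_add_right,
          real_inner_smul_left, real_inner_smul_right]
        rw [e1, e2, e3, e4, e5, e6, e4', e5', e6', sadd]
        linear_combination (-A ^ 2) * cb - B ^ 2 * ca)
      (by
        simp only [inner_sub_left, inner_add_left, real_inner_smul_left]
        rw [e3, e4, e5', sadd]
        ring)
    have w2 : inner ℝ n (B • mphS x + A • mphS y - S • mphS z) = 0 := by rw [w1, inner_zero_right]
    simp only [inner_sub_right, inner_add_right, real_inner_smul_right] at w2
    have : S * (inner ℝ n (mphS z) - m * mphT z) ≤ 0 := by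
      have : S * (inner ℝ n (mphS z) - m * mphT z) = B * (inner ℝ n (mphS x) - m * mphT x) +
        A * (inner ℝ n (mphS y) - m * mphT y) := by linear_combination (-1) * w2 + m * w0
      rw [this]
      have := mul_nonneg sb (neg_nonneg.2 hxn)
      have := mul_nonneg sa (neg_nonneg.2 hyn)
      linarith
    by_contra hcon
    push Not at hcon
    have := mul_pos s0 hcon
    linarith

lemma mph_greedy {E : Type*} [MetricSpace E] (V : Finset E) (B : ℝ) (hB : 0 < B) : ∃ l : E → ℝ,
    (∀ v ∈ V, ∀ w ∈ V, v ≠ w → min (l v) (l w) ≤ dist v w) ∧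
    ∀ τ : ℝ, 0 < τ → τ ≤ B → ∀ x ∈ V, ∃ v ∈ V, τ ≤ l v ∧ dist x v < τ := by
  classical
  rcases V.eq_empty_or_nonempty with rfl | hV
  · exact ⟨fun _ => 0, by simp, by simp⟩
  have step : ∀ n : ℕ, n + 1 ≤ V.card → ∃ W ⊆ V, W.card = n + 1 ∧ ∃ (l : E → ℝ) (ρ : ℝ),
      (∀ v ∈ W, ∀ w ∈ W, v ≠ w → min (l v) (l w) ≤ dist v w) ∧ (∀ w ∈ W, ρ ≤ l w) ∧
      ∀ τ : ℝ, 0 < τ → τ ≤ B → ρ < τ → ∀ x ∈ V, ∃ v ∈ W, τ ≤ l v ∧ dist x v < τ := by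
    intro n
    induction n with
    | zero =>
      intro _
      obtain ⟨x₀, hx₀⟩ := hV
      refine ⟨{x₀}, by simpa using hx₀, by simp, fun _ => B, B, ?_, by simp, ?_⟩
      · intro v hv w hw hvw
        rw [Finset.mem_singleton] at hv hw
        exact absurd (hv.trans hw.symm) hvw
      · intro τ _ h1 h2
        linarith
    | succ n ih =>
      intro hn
      obtain ⟨W, hWV, hWc, l, ρ, h1, h2, h3⟩ := ih (by omega)
      have hW : W.Nonempty := Finset.card_pos.1 (by omega)
      have hne : (V \ W).Nonempty := by
        rw [← Finset.card_pos, Finset.card_sdiff_of_subset hWV]; omega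
      set f : E → ℝ := fun x => W.inf' hW (fun w => dist x w) with hf
      obtain ⟨x, hx, hmax⟩ := (V \ W).exists_max_image f hne
      rw [Finset.mem_sdiff] at hx
      have hfw : ∀ y, ∃ w ∈ W, f y = dist y w := fun y =>
        Finset.exists_mem_eq_inf' hW _
      have hfle : ∀ y, ∀ w ∈ W, f y ≤ dist y w := fun y w hw => Finset.inf'_le _ hw
      have hf0 : 0 ≤ f x := by
        obtain ⟨w, _, hw⟩ := hfw x
        rw [hw]; exact dist_nonneg
      have hf0' : 0 < f x := by
        rcases hf0.lt_or_eq with h | h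
        · exact h
        · obtain ⟨v, hv, he⟩ := hfw x
          rw [← h] at he
          have := dist_eq_zero.1 he.symm
          exact absurd (this ▸ hv) hx.2
      set σ := min (f x) B with hσ
      have hσf : σ ≤ f x := min_le_left _ _
      have hle : ∀ w ∈ W, σ ≤ l w := by
        intro w hw
        by_contra hcon
        push Not at hcon
        have hρ := h2 w hw
        obtain ⟨v, hv, -, hd⟩ := h3 σ (lt_min hf0' hB) (min_le_right _ _) (by linarith) x hx.1
        linarith [hfle x v hv]
      refine ⟨insert x W, ?_, ?_, fun y => if y = x then σ else l y, σ, ?_, ?_, ?_⟩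
      · intro y hy
        rcases Finset.mem_insert.1 hy with rfl | h
        · exact hx.1
        · exact hWV h
      · rw [Finset.card_insert_of_notMem hx.2, hWc]
      · intro v hv w hw hvw
        rcases Finset.mem_insert.1 hv with rfl | hv' <;> rcases Finset.mem_insert.1 hw with rfl | hw'
        · exact absurd rfl hvw
        · simp only [if_true]
          exact (min_le_left _ _).trans (hσf.trans <| hfle _ _ hw')
        · simp only [if_true]
          rw [dist_comm]
          exact (min_le_right _ _).trans (hσf.trans <| hfle _ _ hv')
        · have a1 : v ≠ x := fun h => hx.2 (h ▸ hv')
          have a2 : w ≠ x := fun h => hx.2 (h ▸ hw')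
          simp only [a1, a2, if_false]
          exact h1 v hv' w hw' hvw
      · intro w hw
        rcases Finset.mem_insert.1 hw with rfl | hw'
        · simp
        · have a2 : w ≠ x := fun h => hx.2 (h ▸ hw')
          simp only [a2, if_false]
          exact hle w hw'
      · intro τ h0 hτB hτ y hy
        rcases le_or_gt τ ρ with hle' | hgt
        · have : ∃ v ∈ W, dist y v < τ := by
            by_cases hyW : y ∈ W
            · exact ⟨y, hyW, by simpa using h0⟩
            · obtain ⟨w, hw, he⟩ := hfw y
              refine ⟨w, hw, ?_⟩
              rw [← he]
              exact (hmax y (Finset.mem_sdiff.2 ⟨hy, hyW⟩)).trans_lt (by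
                rcases min_lt_iff.1 hτ with h | h
                · exact h
                · linarith)
          obtain ⟨v, hv, hd⟩ := this
          refine ⟨v, Finset.mem_insert_of_mem hv, ?_, hd⟩
          have a2 : v ≠ x := fun h => hx.2 (h ▸ hv)
          simp only [a2, if_false]
          exact hle'.trans (h2 v hv)
        · obtain ⟨v, hv, hl, hd⟩ := h3 τ h0 hτB hgt y hy
          refine ⟨v, Finset.mem_insert_of_mem hv, ?_, hd⟩
          have a2 : v ≠ x := fun h => hx.2 (h ▸ hv)
          simp only [a2, if_false]
          exact hl
  have hc := Finset.card_pos.2 hV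
  obtain ⟨W, hWV, hWc, l, ρ, h1, h2, h3⟩ := step (V.card - 1) (by omega)
  have : W = V := Finset.eq_of_subset_of_card_le hWV (by omega)
  subst this
  refine ⟨l, h1, fun τ h0 hτB x hx => ?_⟩
  rcases le_or_gt τ ρ with h | h
  · exact ⟨x, hx, h.trans (h2 x hx), by simpa using h0⟩
  · exact h3 τ h0 hτB h x hx


lemma mph_near {d : ℕ} {p x : EuclideanSpace ℝ (Fin d)} (hp : p ∈ hSpace d) {κ : ℝ} (h0 : 0 < κ)
    (h1 : κ ≤ 1 / 4) (hx : ‖x - p‖ ≤ κ * (1 - ‖p‖ ^ 2)) :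
    x ∈ hSpace d ∧ 2 * ‖p - x‖ ^ 2 / ((1 - ‖p‖ ^ 2) * (1 - ‖x‖ ^ 2)) ≤ 4 * κ ^ 2 := by
  have hk := mph_k hp
  have hp1 : ‖p‖ < 1 := by simpa [hSpace] using hp
  have hn : ‖x‖ ≤ ‖p‖ + ‖x - p‖ := by
    have := norm_add_le p (x - p)
    rwa [add_sub_cancel] at this
  have hp0 := norm_nonneg p
  have hx0 := norm_nonneg x
  have hd0 := norm_nonneg (x - p)
  have e : κ * (1 - ‖p‖ ^ 2) ≤ (1 / 4) * (1 - ‖p‖ ^ 2) := by gcongr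
  have hx1 : ‖x‖ < 1 := by nlinarith
  have hxs : x ∈ hSpace d := by simpa [hSpace] using hx1
  refine ⟨hxs, ?_⟩
  have hkx : (1 - ‖p‖ ^ 2) / 2 ≤ 1 - ‖x‖ ^ 2 := by nlinarith
  rw [norm_sub_rev]
  rw [div_le_iff₀ (mul_pos hk (mph_k hxs))]
  have : ‖x - p‖ ^ 2 ≤ (κ * (1 - ‖p‖ ^ 2)) ^ 2 := by gcongr
  have h2 : 0 ≤ κ ^ 2 * (1 - ‖p‖ ^ 2) := by positivity
  have := mul_le_mul_of_nonneg_left hkx h2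
  nlinarith

lemma mph_ball {d : ℕ} {r δ κ : ℝ} (hδ : ∀ s, 0 ≤ s → s ≤ δ → arcosh (1 + s) < r)
    (h0 : 0 < κ) (h1 : κ ≤ 1 / 4) (h2 : 4 * κ ^ 2 ≤ δ)
    {K : Set (EuclideanSpace ℝ (Fin d))} {p : EuclideanSpace ℝ (Fin d)} (hp : p ∈ hSpace d)
    (hpK : p ∈ K) (hfar : ¬ hDistSet p (hFrontier K) ≤ r)
    {x : EuclideanSpace ℝ (Fin d)} (hx : ‖x - p‖ ≤ κ * (1 - ‖p‖ ^ 2)) : x ∈ K := by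
  by_contra hxK
  have hk := mph_k hp
  have hpre : IsPreconnected (closedBall p (κ * (1 - ‖p‖ ^ 2))) :=
    (convex_closedBall _ _).isPreconnected
  have hne : (closedBall p (κ * (1 - ‖p‖ ^ 2)) ∩ frontier K).Nonempty := by
    by_contra hem
    rw [Set.not_nonempty_iff_eq_empty] at hem
    have hsub : closedBall p (κ * (1 - ‖p‖ ^ 2)) ⊆ interior K ∪ interior Kᶜ := by
      rw [← compl_frontier_eq_union_interior]
      intro y hy hyf
      have : y ∈ (∅ : Set (EuclideanSpace ℝ (Fin d))) := hem ▸ ⟨hy, hyf⟩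
      exact this
    have pm : p ∈ closedBall p (κ * (1 - ‖p‖ ^ 2)) := mem_closedBall_self (by positivity)
    have xm : x ∈ closedBall p (κ * (1 - ‖p‖ ^ 2)) := by
      rw [mem_closedBall, dist_eq_norm]; exact hx
    obtain ⟨y, -, hy1, hy2⟩ := hpre _ _ isOpen_interior isOpen_interior hsub
      ⟨p, pm, (hsub pm).resolve_right fun h => interior_subset h hpK⟩
      ⟨x, xm, (hsub xm).resolve_left fun h => hxK (interior_subset h)⟩
    exact interior_subset hy2 (interior_subset hy1)
  obtain ⟨y, hy, hyf⟩ := hne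
  rw [mem_closedBall, dist_eq_norm] at hy
  obtain ⟨hys, hyd⟩ := mph_near hp h0 h1 hy
  apply hfar
  have hlt : hDist p y < r := hδ _ (mph_arg hp hys) (hyd.trans h2)
  refine le_trans (csInf_le ?_ ⟨y, ⟨hys, hyf⟩, rfl⟩) hlt.le
  refine ⟨0, ?_⟩
  rintro _ ⟨z, hz, rfl⟩
  exact mph_nonneg hp hz.1

lemma mph_hull_sub {d : ℕ} {A : Set (EuclideanSpace ℝ (Fin d))} (hA : A ⊆ hSpace d)
    (n : EuclideanSpace ℝ (Fin d)) (m : ℝ) (h : ∀ x ∈ A, 2 * inner ℝ n x ≤ m * (1 + ‖x‖ ^ 2))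
    {q : EuclideanSpace ℝ (Fin d)} (hq : q ∈ hHull A) : 2 * inner ℝ n q ≤ m * (1 + ‖q‖ ^ 2) := by
  have := hq _ ⟨mph_hconvex n m, fun x hx => ⟨hA hx, h x hx⟩⟩
  exact this.2

lemma mph_half {d : ℕ} {r δ κ : ℝ} (hδ : ∀ s, 0 ≤ s → s ≤ δ → arcosh (1 + s) < r)
    (h0 : 0 < κ) (h1 : κ ≤ 1 / 4) (h2 : 4 * κ ^ 2 ≤ δ)
    {A : Set (EuclideanSpace ℝ (Fin d))} (hfin : A.Finite) (hA : A ⊆ hSpace d)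
    (n : EuclideanSpace ℝ (Fin d)) (hn : n ≠ 0) (m : ℝ)
    {q : EuclideanSpace ℝ (Fin d)} (hq : q ∈ hHull A) (hqm : m * (1 + ‖q‖ ^ 2) < 2 * inner ℝ n q) :
    ∃ v ∈ A, hDistSet v (hFrontier (hHull A)) ≤ r ∧ m * (1 + ‖v‖ ^ 2) < 2 * inner ℝ n v := by
  have hex : ∃ x ∈ A, m * (1 + ‖x‖ ^ 2) < 2 * inner ℝ n x := by
    by_contra hcon
    push Not at hcon
    exact absurd (mph_hull_sub hA n m hcon hq) (not_le.2 hqm)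
  obtain ⟨x, hxA, hx⟩ := hex
  obtain ⟨v, hvA, hv⟩ := Set.exists_max_image A (fun x => 2 * inner ℝ n x / (1 + ‖x‖ ^ 2)) hfin
    ⟨x, hxA⟩
  set M := 2 * inner ℝ n v / (1 + ‖v‖ ^ 2) with hM
  have hpos : ∀ y : EuclideanSpace ℝ (Fin d), 0 < 1 + ‖y‖ ^ 2 := fun y => by positivity
  have hMv : M * (1 + ‖v‖ ^ 2) = 2 * inner ℝ n v := by
    rw [hM]; exact div_mul_cancel₀ _ (hpos v).ne'
  refine ⟨v, hvA, ?_, ?_⟩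
  · by_contra hfar
    have hvs := hA hvA
    have hk := mph_k hvs
    have hvK : v ∈ hHull A := fun K hK => hK.2 hvA
    have hsub : ∀ y ∈ A, 2 * inner ℝ n y ≤ M * (1 + ‖y‖ ^ 2) := fun y hy => by
      rw [← div_le_iff₀ (hpos y)]; exact hv y hy
    set e := n - M • v with he
    have hene : e ≠ 0 := by
      intro h
      have h' : n = M • v := sub_eq_zero.1 h
      rw [h', real_inner_smul_left, real_inner_self_eq_norm_sq] at hMv
      have : M * (1 - ‖v‖ ^ 2) = 0 := by linarith
      rcases mul_eq_zero.1 this with h3 | h3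
      · rw [h3, zero_smul] at h'
        exact hn h'
      · linarith
    have hepos : 0 < ‖e‖ := norm_pos_iff.2 hene
    obtain ⟨t, ht0, ht1, ht2⟩ : ∃ t : ℝ, 0 < t ∧ t * ‖e‖ ≤ κ * (1 - ‖v‖ ^ 2) ∧ t * |M| ≤ 1 := by
      refine ⟨min (κ * (1 - ‖v‖ ^ 2) / ‖e‖) (1 / (|M| + 1)), ?_, ?_, ?_⟩
      · apply lt_min <;> positivity
      · rw [← le_div_iff₀ hepos]; exact min_le_left _ _
      · calc _ ≤ (1 / (|M| + 1)) * |M| := by gcongr; exact min_le_right _ _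
          _ ≤ 1 := by
            rw [one_div, inv_mul_le_iff₀ (by positivity)]; linarith
    have hin : v + t • e ∈ hHull A := by
      apply mph_ball hδ h0 h1 h2 hvs hvK hfar
      rw [add_sub_cancel_left, norm_smul, Real.norm_eq_abs, abs_of_pos ht0]
      exact ht1
    have := mph_hull_sub hA n M hsub hin
    rw [inner_add_right, real_inner_smul_right, norm_add_sq_real, real_inner_smul_right, norm_smul,
      Real.norm_eq_abs, abs_of_pos ht0] at this
    have e1 : inner ℝ n e = M * inner ℝ v e + ‖e‖ ^ 2 := by
      have : inner ℝ e e = inner ℝ n e - M * inner ℝ v e := by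
        conv_lhs => rw [he]
        rw [inner_sub_left, real_inner_smul_left]
      rw [real_inner_self_eq_norm_sq] at this
      linarith
    rw [e1] at this
    have h5 : t * ‖e‖ ^ 2 * (2 - t * M) ≤ 0 := by nlinarith
    have h6 : t * M ≤ 1 := le_trans (mul_le_mul_of_nonneg_left (le_abs_self M) ht0.le) ht2
    have h7 : 0 < t * ‖e‖ ^ 2 * (2 - t * M) := by
      apply _root_.mul_pos (by positivity); linarith
    linarith
  · have h3 := hv x hxA
    rw [← hMv]
    have : m < M := by
      refine lt_of_lt_of_le ?_ h3
      rw [lt_div_iff₀ (hpos x)]; exact hx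
    exact mul_lt_mul_of_pos_right this (hpos v)

lemma mph_orth {d : ℕ} (hd : 2 ≤ d) (p : EuclideanSpace ℝ (Fin d)) :
    ∃ u : EuclideanSpace ℝ (Fin d), ‖u‖ = 1 ∧ inner ℝ u p = 0 := by
  have hfr : Module.finrank ℝ (Submodule.span ℝ {p}) ≤ 1 := 
    (finrank_span_le_card ({p} : Set (EuclideanSpace ℝ (Fin d)))).trans (by simp)
  have hsum := Submodule.finrank_add_finrank_orthogonal (Submodule.span ℝ {p})
  rw [finrank_euclideanSpace_fin] at hsum
  have hpos : 0 < Module.finrank ℝ (Submodule.span ℝ {p})ᗮ := by omega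
  have : Nontrivial (Submodule.span ℝ {p})ᗮ := Module.finrank_pos_iff.1 hpos
  obtain ⟨⟨w, hw⟩, hne⟩ := exists_ne (0 : (Submodule.span ℝ {p})ᗮ)
  have hw0 : w ≠ 0 := fun h => hne (Subtype.ext h)
  refine ⟨‖w‖⁻¹ • w, by rw [norm_smul, norm_inv, norm_norm, inv_mul_cancel₀ (norm_ne_zero_iff.2 hw0)], ?_⟩
  rw [real_inner_smul_left, real_inner_comm, Submodule.mem_orthogonal_singleton_iff_inner_right.1 hw,
    mul_zero]

lemma mph_branch {d : ℕ} {r δ κ : ℝ} (hδ : ∀ s, 0 ≤ s → s ≤ δ → arcosh (1 + s) < r)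
    (h0 : 0 < κ) (h1 : κ ≤ 1 / 4) (h2 : 4 * κ ^ 2 ≤ δ)
    {A : Set (EuclideanSpace ℝ (Fin d))} (hfin : A.Finite) (hA : A ⊆ hSpace d)
    {p : EuclideanSpace ℝ (Fin d)} (hpA : p ∈ A)
    (hfar : ¬ hDistSet p (hFrontier (hHull A)) ≤ r)
    {u : EuclideanSpace ℝ (Fin d)} (hu : ‖u‖ = 1) (hup : inner ℝ u p = 0) :
    ∃ v ∈ A, hDistSet v (hFrontier (hHull A)) ≤ r ∧ ‖v - p‖ ≤ (1 - ‖p‖ ^ 2) / κ ∧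
      κ / 64 * (1 - ‖p‖ ^ 2) ≤ inner ℝ u v := by
  have hps := hA hpA
  have hk := mph_k hps
  have hp0 := norm_nonneg p
  have hp1 : ‖p‖ < 1 := by simpa [hSpace] using hps
  set k := 1 - ‖p‖ ^ 2 with hkdef
  have hpK : p ∈ hHull A := fun K hK => hK.2 hpA
  have hpu : inner ℝ p u = 0 := by rw [real_inner_comm, hup]
  have huu : inner ℝ u u = 1 := by rw [real_inner_self_eq_norm_sq, hu]; norm_num
  have hq : p + (κ * k) • u ∈ hHull A := by
    apply mph_ball hδ h0 h1 h2 hps hpK hfar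
    rw [add_sub_cancel_left, norm_smul, hu, Real.norm_eq_abs, abs_of_pos (by positivity), mul_one]
  have hn : (2 * κ) • p + k • u ≠ 0 := by
    intro h
    have h3 : inner ℝ u ((2 * κ) • p + k • u) = 0 := by rw [h, inner_zero_right]
    rw [inner_add_right, real_inner_smul_right, real_inner_smul_right, hup, huu] at h3
    linarith
  obtain ⟨v, hvA, hvr, hv⟩ := mph_half hδ h0 h1 h2 hfin hA _ hn (κ * (1 + ‖p‖ ^ 2)) hq (by
    rw [norm_add_sq_real, real_inner_smul_right, hpu, norm_smul, hu, Real.norm_eq_abs,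
      abs_of_pos (by positivity : 0 < κ * k)]
    simp only [inner_add_left, inner_add_right, real_inner_smul_left, real_inner_smul_right, hpu,
      hup, huu, real_inner_self_eq_norm_sq]
    have e1 : ‖p‖ ^ 2 = 1 - k := by rw [hkdef]; ring
    rw [e1]
    have hk1 : k ≤ 1 := by rw [hkdef]; nlinarith
    have : 0 < κ * k ^ 2 * (1 - (2 - k) * κ ^ 2) := by
      apply _root_.mul_pos (by positivity)
      nlinarith
    nlinarith)
  have hvs := hA hvA
  have hkv := mph_k hvs
  have huv : inner ℝ u v = inner ℝ u (v - p) := by rw [inner_sub_right, hup, sub_zero]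
  have huv1 : inner ℝ u v ≤ ‖v - p‖ := by
    rw [huv]
    have := real_inner_le_norm u (v - p)
    rwa [hu, one_mul] at this
  have hmain : κ * (2 * ‖v - p‖ ^ 2 + k * (1 - ‖v‖ ^ 2)) < 2 * k * inner ℝ u v := by
    rw [norm_sub_sq_real, hkdef]
    rw [inner_add_left, real_inner_smul_left, real_inner_smul_left] at hv
    rw [real_inner_comm p v]
    rw [hkdef] at hv
    linarith
  refine ⟨v, hvA, hvr, ?_, ?_⟩
  · rw [le_div_iff₀ h0]
    have hd0 := norm_nonneg (v - p)
    by_contra hcon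
    push Not at hcon
    have h3 : 0 ≤ κ * (k * (1 - ‖v‖ ^ 2)) := by positivity
    nlinarith
  · have hd0 := norm_nonneg (v - p)
    have hv1 : ‖v‖ ≤ ‖p‖ + ‖v - p‖ := by
      have := norm_add_le p (v - p)
      rwa [add_sub_cancel] at this
    have hv0 := norm_nonneg v
    have hvlt : ‖v‖ < 1 := by simpa [hSpace] using hvs
    have hlow : k ^ 2 / 32 ≤ 2 * ‖v - p‖ ^ 2 + k * (1 - ‖v‖ ^ 2) := by
      rcases le_or_gt (k / 8) ‖v - p‖ with h | h
      · have : (k / 8) ^ 2 ≤ ‖v - p‖ ^ 2 := by gcongr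
        have : 0 ≤ k * (1 - ‖v‖ ^ 2) := by positivity
        nlinarith
      · have : k / 2 ≤ 1 - ‖v‖ ^ 2 := by
          have : ‖v‖ ^ 2 - ‖p‖ ^ 2 ≤ 2 * ‖v - p‖ := by nlinarith
          rw [hkdef] at h ⊢
          linarith
        nlinarith [sq_nonneg ‖v - p‖]
    have h3 : κ * (k ^ 2 / 32) < 2 * k * inner ℝ u v :=
      (mul_le_mul_of_nonneg_left hlow h0.le).trans_lt hmain
    by_contra hcon
    push Not at hcon
    nlinarith [mul_lt_mul_of_pos_left hcon hk]

lemma mph_pack (d : ℕ) (R : ℝ) : ∃ M : ℕ, ∀ (F : Finset (EuclideanSpace ℝ (Fin d)))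
    (v : EuclideanSpace ℝ (Fin d)) (l : ℝ), 0 < l → (∀ x ∈ F, dist x v ≤ R * l) →
    (∀ x ∈ F, ∀ y ∈ F, x ≠ y → l ≤ dist x y) → F.card ≤ M := by
  classical
  obtain ⟨t, -, htf, ht⟩ := (isCompact_closedBall (0 : EuclideanSpace ℝ (Fin d)) R).finite_cover_balls
    (show (0 : ℝ) < 1 / 2 by norm_num)
  refine ⟨htf.toFinset.card, fun F v l hl hF hs => ?_⟩
  have hex : ∀ x ∈ F, ∃ c ∈ t, dist (l⁻¹ • (x - v)) c < 1 / 2 := by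
    intro x hx
    have : l⁻¹ • (x - v) ∈ closedBall (0 : EuclideanSpace ℝ (Fin d)) R := by
      rw [mem_closedBall, dist_zero_right, norm_smul, Real.norm_eq_abs, abs_of_pos (by positivity),
        inv_mul_le_iff₀ hl, ← dist_eq_norm, mul_comm]
      exact hF x hx
    have := ht this
    simpa using this
  choose! f hf hfd using hex
  apply Finset.card_le_card_of_injOn f
  · intro x hx
    simpa using hf x hx
  · intro x hx y hy hxy
    by_contra hne
    have h1 := hfd x hx
    have h2 := hfd y hy
    rw [← hxy] at h2
    have h3 : dist (l⁻¹ • (x - v)) (l⁻¹ • (y - v)) < 1 := by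
      have := dist_triangle_right (l⁻¹ • (x - v)) (l⁻¹ • (y - v)) (f x)
      linarith
    rw [dist_eq_norm, ← smul_sub, sub_sub_sub_cancel_right, norm_smul, Real.norm_eq_abs,
      abs_of_pos (by positivity), inv_mul_lt_iff₀ hl, ← dist_eq_norm] at h3
    have := hs x hx y hy hne
    linarith

/-- **Lemma 2.** There is a constant `c₁ = c₁(d,c) > 0` such that every finite `c`-separated
set `A` of points of `ℍ^d` has at least `c₁·|A|` points at distance at most `(1-c)/2` from
the boundary of the convex hull of `A`. -/
theorem many_points_near_hull_boundary (d : ℕ) (hd : 2 ≤ d) (c : ℝ) (hc0 : 0 < c)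
    (hc1 : c < 1) :
    ∃ c₁ : ℝ, 0 < c₁ ∧
      ∀ A : Set (EuclideanSpace ℝ (Fin d)), A.Finite → A ⊆ hSpace d → hSep c A →
        c₁ * (A.ncard : ℝ) ≤
          (({x ∈ A | hDistSet x (hFrontier (hHull A)) ≤ (1 - c) / 2}).ncard : ℝ) := by
  classical
  obtain ⟨δ, hδ0, hδ⟩ := mph_small ((1 - c) / 2) (by linarith)
  obtain ⟨δ₂, hδ₂0, hδ₂⟩ := mph_small c hc0
  set κ : ℝ := min (1 / 4) δ with hκ
  have h0 : 0 < κ := lt_min (by norm_num) hδ0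
  have h1 : κ ≤ 1 / 4 := min_le_left _ _
  have h2 : 4 * κ ^ 2 ≤ δ := by
    have : κ ≤ δ := min_le_right _ _
    nlinarith
  set s : ℝ := Real.sqrt δ₂ * κ / 8 with hs
  have hs0 : 0 < s := by positivity
  have hs2 : s ^ 2 = δ₂ * κ ^ 2 / 64 := by
    rw [hs, div_pow, mul_pow, Real.sq_sqrt hδ₂0.le]; norm_num
  obtain ⟨M, hM⟩ := mph_pack d (128 / (κ ^ 2 * s))
  refine ⟨1 / (M + 1), by positivity, fun A hfin hA hsep => ?_⟩
  set r := (1 - c) / 2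
  set near : EuclideanSpace ℝ (Fin d) → Prop := fun x => hDistSet x (hFrontier (hHull A)) ≤ r
  set V : Finset (EuclideanSpace ℝ (Fin d)) := hfin.toFinset.filter near with hV
  set P : Finset (EuclideanSpace ℝ (Fin d)) := hfin.toFinset.filter (fun x => ¬ near x) with hP
  have hVc : ({x ∈ A | hDistSet x (hFrontier (hHull A)) ≤ r}).ncard = V.card := by
    rw [← Set.ncard_coe_finset]
    congr 1
    ext x
    simp [hV, near]
  have hAc : A.ncard = V.card + P.card := by
    rw [Set.ncard_eq_toFinset_card A hfin, hV, hP, Finset.card_filter_add_card_filter_not]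
  obtain ⟨l, hl1, hl2⟩ := mph_greedy V 1 one_pos
  have key : ∀ p ∈ P, ∃ v ∈ V, κ / 64 * (1 - ‖p‖ ^ 2) ≤ l v ∧ l v ≤ 4 * (1 - ‖p‖ ^ 2) / κ ∧
      dist p v ≤ 2 * (1 - ‖p‖ ^ 2) / κ := by
    intro p hp
    rw [hP, Finset.mem_filter, Set.Finite.mem_toFinset] at hp
    obtain ⟨hpA, hfar⟩ := hp
    have hk := mph_k (hA hpA)
    obtain ⟨u, hu, hup⟩ := mph_orth hd p
    obtain ⟨y, hyA, hyr, hyp, hyu⟩ := mph_branch hδ h0 h1 h2 hfin hA hpA hfar hu hup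
    obtain ⟨z, hzA, hzr, hzp, hzu⟩ := mph_branch hδ h0 h1 h2 hfin hA hpA hfar
      (u := -u) (by rw [norm_neg, hu]) (by rw [inner_neg_left, hup, neg_zero])
    rw [inner_neg_left] at hzu
    have hyV : y ∈ V := by
      rw [hV, Finset.mem_filter, Set.Finite.mem_toFinset]; exact ⟨hyA, hyr⟩
    have hzV : z ∈ V := by
      rw [hV, Finset.mem_filter, Set.Finite.mem_toFinset]; exact ⟨hzA, hzr⟩
    set k := 1 - ‖p‖ ^ 2 with hkd
    have hk1 : k ≤ 1 := by
      have := sq_nonneg ‖p‖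
      linarith
    have hτ0 : 0 < κ / 64 * k := by positivity
    have hτ1 : κ / 64 * k ≤ 1 := by nlinarith
    obtain ⟨y', hy'V, hy'l, hy'd⟩ := hl2 _ hτ0 hτ1 y hyV
    obtain ⟨z', hz'V, hz'l, hz'd⟩ := hl2 _ hτ0 hτ1 z hzV
    have hin : ∀ w : EuclideanSpace ℝ (Fin d), |inner ℝ u w| ≤ ‖w‖ := by
      intro w
      have := abs_real_inner_le_norm u w
      rwa [hu, one_mul] at this
    have a1 : 0 < inner ℝ u y' := by
      have := (le_abs_self _).trans (hin (y - y'))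
      rw [inner_sub_right, ← dist_eq_norm] at this
      linarith
    have a2 : inner ℝ u z' < 0 := by
      have := (neg_abs_le (inner ℝ u (z - z'))).trans' (neg_le_neg (hin (z - z')))
      rw [inner_sub_right, ← dist_eq_norm] at this
      linarith
    have hne : y' ≠ z' := by
      rintro rfl
      linarith
    have hτk : κ / 64 * k ≤ k / κ := by
      rw [le_div_iff₀ h0]
      nlinarith
    rw [← dist_eq_norm] at hyp hzp
    have e2 : 2 * k / κ = k / κ + k / κ := by ring
    have e4 : 4 * k / κ = k / κ + k / κ + k / κ + k / κ := by ring
    have d1 : dist p y' ≤ 2 * k / κ := by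
      have := dist_triangle_left p y' y
      rw [e2]; linarith
    have d2 : dist p z' ≤ 2 * k / κ := by
      have := dist_triangle_left p z' z
      rw [e2]; linarith
    have d3 : dist y' z' ≤ 4 * k / κ := by
      have := dist_triangle_left y' z' p
      rw [e2] at d1 d2
      rw [e4]; linarith
    have hmin := (hl1 y' hy'V z' hz'V hne).trans d3
    rcases min_le_iff.1 hmin with h | h
    · exact ⟨y', hy'V, hy'l, h, d1⟩
    · exact ⟨z', hz'V, hz'l, h, d2⟩
  choose! f hfV hf1 hf2 hf3 using key
  have hcard : P.card ≤ M * V.card := by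
    apply Finset.card_le_mul_card_image_of_maps_to hfV
    intro v hv
    rcases Finset.eq_empty_or_nonempty (P.filter fun a => f a = v) with he | ⟨p₀, hp₀⟩
    · rw [he]; simp
    have hPA : ∀ p ∈ P, p ∈ A := fun p hp => by
      rw [hP, Finset.mem_filter, Set.Finite.mem_toFinset] at hp
      exact hp.1
    have hlv : 0 < l v := by
      rw [Finset.mem_filter] at hp₀
      have hk := mph_k (hA (hPA p₀ hp₀.1))
      have := hf1 p₀ hp₀.1
      rw [hp₀.2] at this
      exact lt_of_lt_of_le (by positivity) this
    apply hM _ v (s * l v) (by positivity)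
    · intro p hp
      rw [Finset.mem_filter] at hp
      have b1 := hf1 p hp.1
      have b3 := hf3 p hp.1
      rw [hp.2] at b1 b3
      refine b3.trans ?_
      rw [div_le_iff₀ h0]
      have e : 128 / (κ ^ 2 * s) * (s * l v) * κ = 128 / κ * l v := by field_simp
      rw [e, div_mul_eq_mul_div, le_div_iff₀ h0]
      linarith
    · intro p hp q hq hpq
      rw [Finset.mem_filter] at hp hq
      have b2 := hf2 p hp.1
      have c2 := hf2 q hq.1
      rw [hp.2, le_div_iff₀ h0] at b2
      rw [hq.2, le_div_iff₀ h0] at c2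
      have hpA := hPA p hp.1
      have hqA := hPA q hq.1
      have hkp := mph_k (hA hpA)
      have hkq := mph_k (hA hqA)
      have hd' := hsep p hpA q hqA hpq
      have hbig : δ₂ < 2 * ‖p - q‖ ^ 2 / ((1 - ‖p‖ ^ 2) * (1 - ‖q‖ ^ 2)) := by
        by_contra hcon
        push Not at hcon
        have := hδ₂ _ (mph_arg (hA hpA) (hA hqA)) hcon
        rw [hDist] at hd'
        linarith
      rw [lt_div_iff₀ (by positivity)] at hbig
      have hprod : (l v * κ) * (l v * κ) ≤ (4 * (1 - ‖p‖ ^ 2)) * (4 * (1 - ‖q‖ ^ 2)) :=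
        mul_le_mul b2 c2 (by positivity) (by positivity)
      rw [dist_eq_norm]
      refine abs_le_of_sq_le_sq' ?_ (norm_nonneg _) |>.2
      rw [mul_pow, hs2]
      have := mul_le_mul_of_nonneg_left hprod hδ₂0.le
      have : 0 ≤ δ₂ * (l v * κ) ^ 2 := by positivity
      nlinarith
  rw [hVc, hAc, div_mul_eq_mul_div, one_mul, div_le_iff₀ (by positivity)]
  have : (P.card : ℝ) ≤ M * V.card := by exact_mod_cast hcard
  push_cast
  linarith
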